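/- (i) Let β ≥ 1 and ε > 0, and suppose u_ε is admissible for the scalar problem with G_ε(u_ε) = I_GL(ε). Then the map U_ε := (1/√2)(u_ε, u_ε) is admissible with degrees (1,1) and E_ε(U_ε) = I_{[1,1]}(ε;β), i.e. U_ε minimizes E_ε. (ii) Let 0 < β < 1; assume the core energies Q_GL, Q_{[1,1]}(β) and Q_{[1,0]}(β) exist, that Q_{[1,1]}(β) ≤ 2·Q_{[1,0]}(β), and that for each ε ∈ (0,1) there is an admissible scalar map u_ε with G_ε(u_ε) = I_GL(ε) and (1/ε²)·∫_{D₁}(1−|u_ε|²)² dx → 2π as ε → 0⁺. Then there exists ε₀ > 0 such that for all 0 < ε < ε₀ one has I_{[1,1]}(ε;β) < I_GL(ε); in particular E_ε(U_ε) > I_{[1,1]}(ε;β), so U_ε is not a minimizer of E_ε among maps admissible with degrees (1,1). -/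

import Mathlib

open MeasureTheory Metric Set Filter Complex

noncomputable section

/-- Sum of squared norms of the two first-order partial derivatives (plane identified with `ℂ`). -/
def gradSq (f : ℂ → ℂ) (x : ℂ) : ℝ :=
  ‖fderiv ℝ f x 1‖ ^ 2 + ‖fderiv ℝ f x Complex.I‖ ^ 2

/-- Two-component Ginzburg–Landau energy density on the unit disk. -/
def eDen (ε β : ℝ) (ψp ψm : ℂ → ℂ) (x : ℂ) : ℝ :=
  (1 / 2) * (gradSq ψp x + gradSq ψm x)
    + (1 / (4 * ε ^ 2)) * ((‖ψp x‖ ^ 2 + ‖ψm x‖ ^ 2 - 1) ^ 2)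
    + (β / (4 * ε ^ 2)) * ((‖ψp x‖ ^ 2 - ‖ψm x‖ ^ 2) ^ 2)

/-- Two-component Ginzburg–Landau energy on the unit disk. -/
def En (ε β : ℝ) (ψp ψm : ℂ → ℂ) : ℝ := ∫ x in ball (0 : ℂ) 1, eDen ε β ψp ψm x

/-- Scalar Ginzburg–Landau energy density. -/
def gDen (ε : ℝ) (u : ℂ → ℂ) (x : ℂ) : ℝ :=
  (1 / 2) * gradSq u x + (1 / (4 * ε ^ 2)) * ((1 - ‖u x‖ ^ 2) ^ 2)

/-- Scalar Ginzburg–Landau energy on the unit disk. -/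
def Gn (ε : ℝ) (u : ℂ → ℂ) : ℝ := ∫ x in ball (0 : ℂ) 1, gDen ε u x

/-- Admissible two-component map with boundary degrees `(np, nm)`. -/
def AdmissiblePair (ε β : ℝ) (np nm : ℕ) (ψp ψm : ℂ → ℂ) : Prop :=
  ContinuousOn ψp (closedBall 0 1) ∧ ContinuousOn ψm (closedBall 0 1) ∧
  ContDiffOn ℝ 1 ψp (ball 0 1) ∧ ContDiffOn ℝ 1 ψm (ball 0 1) ∧
  IntegrableOn (eDen ε β ψp ψm) (ball 0 1) ∧
  ∀ x : ℂ, ‖x‖ = 1 →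
    ψp x = (Real.sqrt 2 : ℂ)⁻¹ * x ^ np ∧ ψm x = (Real.sqrt 2 : ℂ)⁻¹ * x ^ nm

/-- The infimum `I_{[np,nm]}(ε;β)`. -/
def Ival (ε β : ℝ) (np nm : ℕ) : ℝ :=
  sInf { e : ℝ | ∃ ψp ψm : ℂ → ℂ, AdmissiblePair ε β np nm ψp ψm ∧ e = En ε β ψp ψm }

/-- Admissible scalar map with degree-one boundary condition. -/
def AdmissibleScalar (ε : ℝ) (u : ℂ → ℂ) : Prop :=
  ContinuousOn u (closedBall 0 1) ∧ ContDiffOn ℝ 1 u (ball 0 1) ∧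
  IntegrableOn (gDen ε u) (ball 0 1) ∧ ∀ x : ℂ, ‖x‖ = 1 → u x = x

/-- The infimum `I_GL(ε)`. -/
def IGL (ε : ℝ) : ℝ :=
  sInf { e : ℝ | ∃ u : ℂ → ℂ, AdmissibleScalar ε u ∧ e = Gn ε u }

/-- Spin of a two-component map. -/
def spin (ψp ψm : ℂ → ℂ) (x : ℂ) : ℝ := (1 / 2) * (‖ψm x‖ ^ 2 - ‖ψp x‖ ^ 2)

lemma norm_inv_sqrt_two_sq : ‖(Real.sqrt 2 : ℂ)⁻¹‖ ^ 2 = 1 / 2 := by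
  rw [norm_inv, Complex.norm_real, Real.norm_of_nonneg (Real.sqrt_nonneg 2), inv_pow,
    Real.sq_sqrt (by norm_num)]
  norm_num

lemma norm_sqrt_two_sq : ‖(Real.sqrt 2 : ℂ)‖ ^ 2 = 2 := by
  rw [Complex.norm_real, Real.norm_of_nonneg (Real.sqrt_nonneg 2), Real.sq_sqrt (by norm_num)]

lemma gradSq_const_mul (c : ℂ) (u : ℂ → ℂ) (x : ℂ) :
    gradSq (fun y => c * u y) x = ‖c‖ ^ 2 * gradSq u x := by
  have h : fderiv ℝ (fun y => c * u y) x = c • fderiv ℝ u x :=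
    congrFun (fderiv_const_smul_field (𝕜 := ℝ) (f := u) c) x
  simp only [gradSq, h, smul_apply, norm_smul, mul_pow]
  ring

lemma gradSq_const (c : ℂ) (x : ℂ) : gradSq (fun _ => c) x = 0 := by
  simp [gradSq]

lemma gradSq_nonneg (u : ℂ → ℂ) (x : ℂ) : 0 ≤ gradSq u x := by
  unfold gradSq; positivity

lemma gDen_nonneg (ε : ℝ) (u : ℂ → ℂ) (x : ℂ) : 0 ≤ gDen ε u x := by
  have := gradSq_nonneg u x
  unfold gDen; positivity

lemma eDen_nonneg (ε : ℝ) {β : ℝ} (hβ : 0 ≤ β) (ψp ψm : ℂ → ℂ) (x : ℂ) :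
    0 ≤ eDen ε β ψp ψm x := by
  have := gradSq_nonneg ψp x
  have := gradSq_nonneg ψm x
  unfold eDen; positivity

lemma continuousOn_gDen (ε : ℝ) {u : ℂ → ℂ} (hu : ContDiffOn ℝ 1 u (ball 0 1)) :
    ContinuousOn (gDen ε u) (ball 0 1) := by
  have h := hu.continuousOn_fderiv_of_isOpen isOpen_ball le_rfl
  have h' := hu.continuousOn
  unfold gDen gradSq
  fun_prop

lemma Gn_nonneg (ε : ℝ) (u : ℂ → ℂ) : 0 ≤ Gn ε u :=
  integral_nonneg (gDen_nonneg ε u)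

lemma En_nonneg (ε : ℝ) {β : ℝ} (hβ : 0 ≤ β) (ψp ψm : ℂ → ℂ) : 0 ≤ En ε β ψp ψm :=
  integral_nonneg (eDen_nonneg ε hβ ψp ψm)

lemma IGL_le {ε : ℝ} {u : ℂ → ℂ} (hu : AdmissibleScalar ε u) : IGL ε ≤ Gn ε u := by
  refine csInf_le ⟨0, ?_⟩ ⟨u, hu, rfl⟩
  rintro _ ⟨v, -, rfl⟩
  exact Gn_nonneg ε v

lemma Ival_le {ε β : ℝ} (hβ : 0 ≤ β) {np nm : ℕ} {ψp ψm : ℂ → ℂ}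
    (h : AdmissiblePair ε β np nm ψp ψm) : Ival ε β np nm ≤ En ε β ψp ψm := by
  refine csInf_le ⟨0, ?_⟩ ⟨ψp, ψm, h, rfl⟩
  rintro _ ⟨φp, φm, -, rfl⟩
  exact En_nonneg ε hβ φp φm

lemma eDen_diagonal (ε β : ℝ) (u : ℂ → ℂ) :
    eDen ε β (fun x => (Real.sqrt 2 : ℂ)⁻¹ * u x) (fun x => (Real.sqrt 2 : ℂ)⁻¹ * u x)
      = gDen ε u := by
  funext x
  simp only [eDen, gDen, gradSq_const_mul, norm_mul, mul_pow, norm_inv_sqrt_two_sq]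
  ring

lemma En_diagonal (ε β : ℝ) (u : ℂ → ℂ) :
    En ε β (fun x => (Real.sqrt 2 : ℂ)⁻¹ * u x) (fun x => (Real.sqrt 2 : ℂ)⁻¹ * u x)
      = Gn ε u := by
  rw [En, eDen_diagonal, Gn]

lemma AdmissibleScalar.diagonal {ε : ℝ} (β : ℝ) {u : ℂ → ℂ} (hu : AdmissibleScalar ε u) :
    AdmissiblePair ε β 1 1 (fun x => (Real.sqrt 2 : ℂ)⁻¹ * u x)
      (fun x => (Real.sqrt 2 : ℂ)⁻¹ * u x) := by
  obtain ⟨hc, hd, hi, hb⟩ := hu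
  refine ⟨continuousOn_const.mul hc, continuousOn_const.mul hc, contDiffOn_const.mul hd,
    contDiffOn_const.mul hd, by rwa [eDen_diagonal], fun x hx => ?_⟩
  simp [hb x hx]

/-- For `β ≥ 1` the pair energy controls the mean of the scalar energies of the two rescaled
components. -/
lemma gDen_add_gDen_le (ε : ℝ) {β : ℝ} (hβ : 1 ≤ β) (ψp ψm : ℂ → ℂ) (x : ℂ) :
    gDen ε (fun y => (Real.sqrt 2 : ℂ) * ψp y) x + gDen ε (fun y => (Real.sqrt 2 : ℂ) * ψm y) x
      ≤ 2 * eDen ε β ψp ψm x := by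
  have h : 0 ≤ (β - 1) * (2 * (1 / (4 * ε ^ 2)) * (‖ψp x‖ ^ 2 - ‖ψm x‖ ^ 2) ^ 2) :=
    mul_nonneg (by linarith) (by positivity)
  have h' : 2 * eDen ε β ψp ψm x =
      gDen ε (fun y => (Real.sqrt 2 : ℂ) * ψp y) x + gDen ε (fun y => (Real.sqrt 2 : ℂ) * ψm y) x
      + (β - 1) * (2 * (1 / (4 * ε ^ 2)) * (‖ψp x‖ ^ 2 - ‖ψm x‖ ^ 2) ^ 2) := by
    simp only [eDen, gDen, gradSq_const_mul, norm_mul, mul_pow, norm_sqrt_two_sq]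
    ring
  linarith

lemma admissibleScalar_of_gDen_le {ε : ℝ} {ψ : ℂ → ℂ} {g : ℂ → ℝ}
    (hc : ContinuousOn ψ (closedBall 0 1)) (hd : ContDiffOn ℝ 1 ψ (ball 0 1))
    (hg : IntegrableOn g (ball 0 1))
    (hle : ∀ x, gDen ε (fun y => (Real.sqrt 2 : ℂ) * ψ y) x ≤ g x)
    (hb : ∀ x : ℂ, ‖x‖ = 1 → ψ x = (Real.sqrt 2 : ℂ)⁻¹ * x ^ 1) :
    AdmissibleScalar ε (fun y => (Real.sqrt 2 : ℂ) * ψ y) := by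
  have hd' : ContDiffOn ℝ 1 (fun y => (Real.sqrt 2 : ℂ) * ψ y) (ball 0 1) :=
    contDiffOn_const.mul hd
  refine ⟨continuousOn_const.mul hc, hd', ?_, fun x hx => ?_⟩
  · refine Integrable.mono' hg
      ((continuousOn_gDen ε hd').aestronglyMeasurable measurableSet_ball) (.of_forall fun x => ?_)
    rw [Real.norm_of_nonneg (gDen_nonneg ε _ x)]
    exact hle x
  · have h2 : (Real.sqrt 2 : ℂ) ≠ 0 := by
      rw [Complex.ofReal_ne_zero]; positivity
    simp only [hb x hx, pow_one, mul_inv_cancel_left₀ h2]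

lemma IGL_le_En {ε β : ℝ} (hβ : 1 ≤ β) {ψp ψm : ℂ → ℂ} (h : AdmissiblePair ε β 1 1 ψp ψm) :
    IGL ε ≤ En ε β ψp ψm := by
  obtain ⟨hcp, hcm, hdp, hdm, hi, hb⟩ := h
  have hi2 : IntegrableOn (fun x => 2 * eDen ε β ψp ψm x) (ball 0 1) := hi.const_mul 2
  have hle := gDen_add_gDen_le ε hβ ψp ψm
  have hp := admissibleScalar_of_gDen_le hcp hdp hi2
    (fun x => (le_add_of_nonneg_right (gDen_nonneg ε _ x)).trans (hle x)) fun x hx => (hb x hx).1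
  have hm := admissibleScalar_of_gDen_le hcm hdm hi2
    (fun x => (le_add_of_nonneg_left (gDen_nonneg ε _ x)).trans (hle x)) fun x hx => (hb x hx).2
  have hsum := integral_mono (hp.2.2.1.add hm.2.2.1) hi2 hle
  rw [integral_add' hp.2.2.1 hm.2.2.1, integral_const_mul] at hsum
  have h1 := IGL_le hp
  have h2 := IGL_le hm
  unfold Gn at h1 h2
  unfold En
  linarith

lemma eDen_const_right (ε β : ℝ) (u : ℂ → ℂ) (x : ℂ) :
    eDen ε β (fun x => (Real.sqrt 2 : ℂ)⁻¹ * u x) (fun _ => (Real.sqrt 2 : ℂ)⁻¹) x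
      = (1 / 2) * gDen ε u x - (1 - β) / (16 * ε ^ 2) * (1 - ‖u x‖ ^ 2) ^ 2 := by
  simp only [eDen, gDen, gradSq_const_mul, gradSq_const, norm_mul, mul_pow, norm_inv_sqrt_two_sq]
  ring

/-- Pairing a scalar competitor with a constant second component bounds the degree `(1,0)`
infimum. -/
lemma Ival_one_zero_le {ε β : ℝ} (hβ : 0 ≤ β) {u : ℂ → ℂ} (hu : AdmissibleScalar ε u) :
    Ival ε β 1 0 ≤ (1 / 2) * Gn ε u
      - (1 - β) / 16 * ((1 / ε ^ 2) * ∫ x in ball (0 : ℂ) 1, (1 - ‖u x‖ ^ 2) ^ 2) := by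
  obtain ⟨hc, hd, hi, hb⟩ := hu
  have hpot : IntegrableOn (fun x => (1 - ‖u x‖ ^ 2) ^ 2) (ball (0 : ℂ) 1) := by
    have h : ContinuousOn (fun x => (1 - ‖u x‖ ^ 2) ^ 2) (closedBall (0 : ℂ) 1) := by fun_prop
    exact (h.integrableOn_compact (isCompact_closedBall 0 1)).mono_set ball_subset_closedBall
  have hi1 : IntegrableOn (fun x => (1 / 2) * gDen ε u x) (ball 0 1) := hi.const_mul _
  have hi2 : IntegrableOn (fun x => (1 - β) / (16 * ε ^ 2) * (1 - ‖u x‖ ^ 2) ^ 2)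
      (ball 0 1) := hpot.const_mul _
  have heq := funext (eDen_const_right ε β u)
  have hadm : AdmissiblePair ε β 1 0 (fun x => (Real.sqrt 2 : ℂ)⁻¹ * u x)
      (fun _ => (Real.sqrt 2 : ℂ)⁻¹) := by
    refine ⟨continuousOn_const.mul hc, continuousOn_const, contDiffOn_const.mul hd,
      contDiffOn_const, ?_, fun x hx => ?_⟩
    · rw [heq]
      exact hi1.sub hi2
    · simp [hb x hx]
  refine (Ival_le hβ hadm).trans_eq ?_
  rw [En, heq, integral_sub hi1 hi2, integral_const_mul, integral_const_mul, Gn]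
  ring

/-- (i) For `β ≥ 1` and `ε > 0`, if `u_ε` minimizes the scalar problem, then
`U_ε = (1/√2)(u_ε,u_ε)` is admissible with degrees `(1,1)` and minimizes `E_ε`.
(ii) For `0 < β < 1`, under the stated core-energy hypotheses, there is `ε₀ > 0`
such that for `0 < ε < ε₀` one has `I_{[1,1]}(ε;β) < I_GL(ε)`, and in particular
`E_ε(U_ε) > I_{[1,1]}(ε;β)`, so `U_ε` is not a minimizer. -/
theorem statement7 :
    (∀ β : ℝ, 1 ≤ β → ∀ ε > (0 : ℝ), ∀ u : ℂ → ℂ,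
      AdmissibleScalar ε u → Gn ε u = IGL ε →
      AdmissiblePair ε β 1 1 (fun x => (Real.sqrt 2 : ℂ)⁻¹ * u x)
          (fun x => (Real.sqrt 2 : ℂ)⁻¹ * u x) ∧
        En ε β (fun x => (Real.sqrt 2 : ℂ)⁻¹ * u x)
          (fun x => (Real.sqrt 2 : ℂ)⁻¹ * u x) = Ival ε β 1 1) ∧
    (∀ β QGL Q11 Q10 : ℝ, 0 < β → β < 1 →
      Tendsto (fun ε => IGL ε - Real.pi * Real.log (1 / ε))
        (nhdsWithin 0 (Ioi 0)) (nhds QGL) →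
      Tendsto (fun ε => Ival ε β 1 1 - Real.pi * Real.log (1 / ε))
        (nhdsWithin 0 (Ioi 0)) (nhds Q11) →
      Tendsto (fun ε => Ival ε β 1 0 - (Real.pi / 2) * Real.log (1 / ε))
        (nhdsWithin 0 (Ioi 0)) (nhds Q10) →
      Q11 ≤ 2 * Q10 →
      ∀ u : ℝ → ℂ → ℂ,
        (∀ ε ∈ Ioo (0 : ℝ) 1, AdmissibleScalar ε (u ε) ∧ Gn ε (u ε) = IGL ε) →
        Tendsto (fun ε => (1 / ε ^ 2) * ∫ x in ball (0 : ℂ) 1, (1 - ‖u ε x‖ ^ 2) ^ 2)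
          (nhdsWithin 0 (Ioi 0)) (nhds (2 * Real.pi)) →
        ∃ ε₀ > (0 : ℝ), ∀ ε : ℝ, 0 < ε → ε < ε₀ →
          Ival ε β 1 1 < IGL ε ∧
          Ival ε β 1 1 < En ε β (fun x => (Real.sqrt 2 : ℂ)⁻¹ * u ε x)
            (fun x => (Real.sqrt 2 : ℂ)⁻¹ * u ε x)) := by
  refine ⟨fun β hβ ε _ u hu hmin => ⟨hu.diagonal β, le_antisymm ?_ ?_⟩, ?_⟩
  · rw [En_diagonal, hmin]
    refine le_csInf ⟨_, _, _, hu.diagonal β, rfl⟩ ?_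
    rintro _ ⟨ψp, ψm, h, rfl⟩
    exact IGL_le_En hβ h
  · exact Ival_le (by linarith) (hu.diagonal β)
  · intro β QGL Q11 Q10 hβ0 hβ1 hGL h11 h10 hQ u hu hpot
    have hQ10 : Q10 ≤ (1 / 2) * QGL - (1 - β) / 16 * (2 * Real.pi) := by
      refine le_of_tendsto_of_tendsto h10 ((hGL.const_mul _).sub (hpot.const_mul _)) ?_
      filter_upwards [Ioo_mem_nhdsGT (zero_lt_one' ℝ)] with ε hε
      have h := Ival_one_zero_le hβ0.le (hu ε hε).1
      rw [(hu ε hε).2] at h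
      linarith
    have hlt : Q11 < QGL := by
      have := mul_pos (sub_pos.2 hβ1) Real.pi_pos
      linarith
    have hev := (h11.eventually_lt hGL hlt).and (Ioo_mem_nhdsGT (zero_lt_one' ℝ))
    obtain ⟨ε₀, hε₀, hsub⟩ := mem_nhdsGT_iff_exists_Ioo_subset.1 hev
    refine ⟨ε₀, hε₀, fun ε hε hεε₀ => ?_⟩
    obtain ⟨h, hε1⟩ := hsub ⟨hε, hεε₀⟩
    have h' : Ival ε β 1 1 < IGL ε := by linarith
    exact ⟨h', by rwa [En_diagonal, (hu ε hε1).2]⟩
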